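/- Let n ≥ 1. There exists a constant C > 0, depending only on n, such that for every u ∈ C^∞(B₁) and f ∈ C^∞(B₁) with Δu = f pointwise in B₁, one has ∫_{B_{1/2}} |D²u|² ≤ C (∫_{B₁} |u|² + ∫_{B₁} |f|²), where the integrals are taken in [0,∞]. -/

import Mathlib

open MeasureTheory Metric

/-- Partial derivative of `u : ℝⁿ → ℝ` in the `i`-th coordinate direction. -/
noncomputable def partialDeriv' {n : ℕ} (i : Fin n)
    (u : EuclideanSpace ℝ (Fin n) → ℝ) : EuclideanSpace ℝ (Fin n) → ℝ :=
  fun x => fderiv ℝ u x (EuclideanSpace.single i 1)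

/-- Entry `(i, j)` of the Hessian matrix `D²u`, i.e. `∂_j ∂_i u`. -/
noncomputable def hessEntry {n : ℕ} (u : EuclideanSpace ℝ (Fin n) → ℝ)
    (i j : Fin n) : EuclideanSpace ℝ (Fin n) → ℝ :=
  partialDeriv' j (partialDeriv' i u)

/-- Squared Frobenius norm `|D²u(x)|²` of the Hessian. -/
noncomputable def hessFrobSq {n : ℕ} (u : EuclideanSpace ℝ (Fin n) → ℝ)
    (x : EuclideanSpace ℝ (Fin n)) : ℝ :=
  ∑ i, ∑ j, (hessEntry u i j x) ^ 2

/-- Laplacian `Δu = tr D²u`. -/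
noncomputable def lap {n : ℕ} (u : EuclideanSpace ℝ (Fin n) → ℝ)
    (x : EuclideanSpace ℝ (Fin n)) : ℝ :=
  ∑ i, hessEntry u i i x

section PartialDerivatives

variable {n : ℕ} {u v : EuclideanSpace ℝ (Fin n) → ℝ}

lemma ContDiff.partialDeriv' (hu : ContDiff ℝ (⊤ : ℕ∞) u) (i : Fin n) :
    ContDiff ℝ (⊤ : ℕ∞) (partialDeriv' i u) :=
  (hu.fderiv_right (by simp)).clm_apply contDiff_const

lemma ContDiff.hessEntry (hu : ContDiff ℝ (⊤ : ℕ∞) u) (i j : Fin n) :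
    ContDiff ℝ (⊤ : ℕ∞) (hessEntry u i j) :=
  (hu.partialDeriv' i).partialDeriv' j

lemma ContDiff.lap (hu : ContDiff ℝ (⊤ : ℕ∞) u) : ContDiff ℝ (⊤ : ℕ∞) (lap u) :=
  ContDiff.sum fun i _ => hu.hessEntry i i

lemma tsupport_partialDeriv'_subset (i : Fin n) :
    tsupport (partialDeriv' i u) ⊆ tsupport u :=
  tsupport_fderiv_apply_subset ℝ _

lemma tsupport_hessEntry_subset (i j : Fin n) : tsupport (hessEntry u i j) ⊆ tsupport u :=
  (tsupport_partialDeriv'_subset j).trans (tsupport_partialDeriv'_subset i)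

lemma HasCompactSupport.partialDeriv' (hu : HasCompactSupport u) (i : Fin n) :
    HasCompactSupport (partialDeriv' i u) :=
  hu.fderiv_apply ℝ _

lemma HasCompactSupport.hessEntry (hu : HasCompactSupport u) (i j : Fin n) :
    HasCompactSupport (hessEntry u i j) :=
  (hu.partialDeriv' i).partialDeriv' j

lemma lap_eq_zero_of_notMem_tsupport {x : EuclideanSpace ℝ (Fin n)} (hx : x ∉ tsupport u) :
    lap u x = 0 :=
  Finset.sum_eq_zero fun i _ =>
    image_eq_zero_of_notMem_tsupport fun h => hx (tsupport_hessEntry_subset i i h)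

lemma HasCompactSupport.lap (hu : HasCompactSupport u) : HasCompactSupport (lap u) :=
  HasCompactSupport.intro hu fun _ hx => lap_eq_zero_of_notMem_tsupport hx

lemma Filter.EventuallyEq.partialDeriv' {x : EuclideanSpace ℝ (Fin n)}
    (h : u =ᶠ[nhds x] v) (i : Fin n) : partialDeriv' i u =ᶠ[nhds x] partialDeriv' i v :=
  h.fderiv.fun_comp fun L => L (EuclideanSpace.single i 1)

lemma Filter.EventuallyEq.hessEntry_eq {x : EuclideanSpace ℝ (Fin n)}
    (h : u =ᶠ[nhds x] v) (i j : Fin n) : hessEntry u i j x = hessEntry v i j x :=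
  ((h.partialDeriv' i).partialDeriv' j).eq_of_nhds

lemma Filter.EventuallyEq.lap_eq {x : EuclideanSpace ℝ (Fin n)}
    (h : u =ᶠ[nhds x] v) : lap u x = lap v x :=
  Finset.sum_congr rfl fun i _ => h.hessEntry_eq i i

lemma Filter.EventuallyEq.hessFrobSq_eq {x : EuclideanSpace ℝ (Fin n)}
    (h : u =ᶠ[nhds x] v) : hessFrobSq u x = hessFrobSq v x :=
  Finset.sum_congr rfl fun i _ => Finset.sum_congr rfl fun j _ => by rw [h.hessEntry_eq i j]

lemma partialDeriv'_comm (hu : ContDiff ℝ (⊤ : ℕ∞) u) (i j : Fin n) :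
    partialDeriv' j (partialDeriv' i u) = partialDeriv' i (partialDeriv' j u) := by
  funext x
  have hd : DifferentiableAt ℝ (fderiv ℝ u) x :=
    ((hu.fderiv_right (m := 1) (by norm_cast)).differentiable (by simp)).differentiableAt
  have hs : IsSymmSndFDerivAt ℝ u x :=
    hu.contDiffAt.isSymmSndFDerivAt (by simpa using WithTop.coe_le_coe.2 (le_top (a := (2 : ℕ∞))))
  unfold partialDeriv'
  rw [fderiv_clm_apply hd (differentiableAt_const _), fderiv_clm_apply hd (differentiableAt_const _)]
  simpa using hs.eq _ _

lemma partialDeriv'_mul (hu : ContDiff ℝ (⊤ : ℕ∞) u) (hv : ContDiff ℝ (⊤ : ℕ∞) v) (i : Fin n) :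
    partialDeriv' i (fun x => u x * v x) =
      fun x => partialDeriv' i u x * v x + u x * partialDeriv' i v x := by
  funext x
  unfold partialDeriv'
  rw [fderiv_fun_mul (hu.differentiable (by simp) x) (hv.differentiable (by simp) x)]
  simp
  ring

lemma partialDeriv'_add (hu : ContDiff ℝ (⊤ : ℕ∞) u) (hv : ContDiff ℝ (⊤ : ℕ∞) v) (i : Fin n) :
    partialDeriv' i (fun x => u x + v x) =
      fun x => partialDeriv' i u x + partialDeriv' i v x := by
  funext x
  unfold partialDeriv'
  rw [fderiv_fun_add (hu.differentiable (by simp) x) (hv.differentiable (by simp) x)]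
  simp

lemma lap_mul (hu : ContDiff ℝ (⊤ : ℕ∞) u) (hv : ContDiff ℝ (⊤ : ℕ∞) v)
    (x : EuclideanSpace ℝ (Fin n)) :
    lap (fun x => u x * v x) x =
      lap u x * v x + 2 * ∑ i, partialDeriv' i u x * partialDeriv' i v x + u x * lap v x := by
  simp only [lap, Finset.sum_mul, Finset.mul_sum, ← Finset.sum_add_distrib]
  refine Finset.sum_congr rfl fun i _ => ?_
  unfold hessEntry
  rw [partialDeriv'_mul hu hv, partialDeriv'_add ((hu.partialDeriv' i).mul hv)
    (hu.mul (hv.partialDeriv' i)), partialDeriv'_mul (hu.partialDeriv' i) hv,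
    partialDeriv'_mul hu (hv.partialDeriv' i)]
  ring

lemma integral_mul_partialDeriv' (hu : ContDiff ℝ (⊤ : ℕ∞) u) (hv : ContDiff ℝ (⊤ : ℕ∞) v)
    (hc : HasCompactSupport u) (i : Fin n) :
    ∫ x, u x * partialDeriv' i v x = -∫ x, partialDeriv' i u x * v x :=
  integral_mul_fderiv_eq_neg_fderiv_mul_of_integrable
    (((hu.partialDeriv' i).mul hv).continuous.integrable_of_hasCompactSupport
      (hc.partialDeriv' i).mul_right)
    ((hu.mul (hv.partialDeriv' i)).continuous.integrable_of_hasCompactSupport hc.mul_right)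
    ((hu.mul hv).continuous.integrable_of_hasCompactSupport hc.mul_right)
    (fun x _ => hu.differentiable (by simp) x) (fun x _ => hv.differentiable (by simp) x)

/-- Green's second identity for a compactly supported factor. -/
lemma integral_mul_lap (hu : ContDiff ℝ (⊤ : ℕ∞) u) (hv : ContDiff ℝ (⊤ : ℕ∞) v)
    (hc : HasCompactSupport u) : ∫ x, u x * lap v x = ∫ x, lap u x * v x := by
  simp only [lap, Finset.sum_mul, Finset.mul_sum]
  rw [integral_finsetSum _ fun i _ => (hu.mul (hv.hessEntry i i)).continuous
      |>.integrable_of_hasCompactSupport hc.mul_right,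
    integral_finsetSum _ fun i _ => ((hu.hessEntry i i).mul hv).continuous
      |>.integrable_of_hasCompactSupport (hc.hessEntry i i).mul_right]
  refine Finset.sum_congr rfl fun i _ => ?_
  unfold hessEntry
  rw [integral_mul_partialDeriv' hu (hv.partialDeriv' i) hc,
    integral_mul_partialDeriv' (hu.partialDeriv' i) hv (hc.partialDeriv' i), neg_neg]

lemma integral_hessEntry_sq (hu : ContDiff ℝ (⊤ : ℕ∞) u) (hc : HasCompactSupport u)
    (i j : Fin n) : ∫ x, hessEntry u i j x ^ 2 = ∫ x, hessEntry u i i x * hessEntry u j j x := by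
  have h₁ := integral_mul_partialDeriv' (hu.hessEntry i j) (hu.partialDeriv' i)
    (hc.hessEntry i j) j
  have h₂ := integral_mul_partialDeriv' (hu.hessEntry j j) (hu.partialDeriv' i)
    (hc.hessEntry j j) i
  have h₃ : partialDeriv' j (hessEntry u i j) = partialDeriv' i (hessEntry u j j) := by
    unfold hessEntry
    rw [partialDeriv'_comm hu i j, partialDeriv'_comm (hu.partialDeriv' j) i j]
  rw [h₃, ← h₂] at h₁
  simpa only [sq, mul_comm, hessEntry] using h₁

/-- For compactly supported functions, the Hessian and the Laplacian have the same `L²` norm. -/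
lemma integral_hessFrobSq (hu : ContDiff ℝ (⊤ : ℕ∞) u) (hc : HasCompactSupport u) :
    ∫ x, hessFrobSq u x = ∫ x, lap u x ^ 2 := by
  have hint (i j k l : Fin n) : Integrable fun x => hessEntry u i j x * hessEntry u k l x :=
    ((hu.hessEntry i j).mul (hu.hessEntry k l)).continuous.integrable_of_hasCompactSupport
      (hc.hessEntry i j).mul_right
  have hsq (i j : Fin n) : Integrable fun x => hessEntry u i j x ^ 2 := by
    simpa only [sq] using hint i j i j
  simp only [hessFrobSq, lap, sq (∑ i, _), Finset.sum_mul_sum]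
  rw [integral_finsetSum _ fun i _ => integrable_finsetSum _ fun j _ => hsq i j,
    integral_finsetSum _ fun i _ => integrable_finsetSum _ fun j _ => hint i i j j]
  refine Finset.sum_congr rfl fun i _ => ?_
  rw [integral_finsetSum _ fun j _ => hsq i j, integral_finsetSum _ fun j _ => hint i i j j]
  exact Finset.sum_congr rfl fun j _ => integral_hessEntry_sq hu hc i j

lemma ContDiff.hessFrobSq (hu : ContDiff ℝ (⊤ : ℕ∞) u) : ContDiff ℝ (⊤ : ℕ∞) (hessFrobSq u) :=
  ContDiff.sum fun i _ => ContDiff.sum fun j _ => (hu.hessEntry i j).pow 2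

lemma HasCompactSupport.hessFrobSq (hu : HasCompactSupport u) :
    HasCompactSupport (hessFrobSq u) :=
  HasCompactSupport.intro hu fun x hx => Finset.sum_eq_zero fun i _ => Finset.sum_eq_zero fun j _ =>
    by rw [image_eq_zero_of_notMem_tsupport fun h => hx (tsupport_hessEntry_subset i j h)]; simp

/-- Caccioppoli-type identity: `½ Δ(v²) = |∇v|² + v Δv`, tested against a cutoff. -/
lemma two_mul_integral_mul_grad_sq (hu : ContDiff ℝ (⊤ : ℕ∞) u) (hv : ContDiff ℝ (⊤ : ℕ∞) v)
    (hc : HasCompactSupport u) :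
    2 * ∫ x, u x * ∑ i, partialDeriv' i v x ^ 2 =
      ∫ x, (lap u x * v x ^ 2 - 2 * (u x * (v x * lap v x))) := by
  have hg : Integrable fun x => u x * ∑ i, partialDeriv' i v x ^ 2 :=
    (hu.mul (ContDiff.sum fun i _ => (hv.partialDeriv' i).pow 2)).continuous
      |>.integrable_of_hasCompactSupport hc.mul_right
  have hl : Integrable fun x => lap u x * v x ^ 2 :=
    (hu.lap.mul (hv.pow 2)).continuous.integrable_of_hasCompactSupport hc.lap.mul_right
  have hvl : Integrable fun x => u x * (v x * lap v x) :=
    (hu.mul (hv.mul hv.lap)).continuous.integrable_of_hasCompactSupport hc.mul_right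
  have h := integral_mul_lap hu (hv.mul hv) hc
  have he (x : EuclideanSpace ℝ (Fin n)) : u x * lap (fun x => v x * v x) x =
      2 * (u x * ∑ i, partialDeriv' i v x ^ 2) + 2 * (u x * (v x * lap v x)) := by
    rw [lap_mul hv hv]
    simp only [← sq]
    ring
  simp only [he] at h
  simp only [← sq] at h
  rw [integral_add (hg.const_mul 2) (hvl.const_mul 2), integral_const_mul] at h
  rw [integral_sub hl (hvl.const_mul 2)]
  linarith

end PartialDerivatives

/-- Two nested cutoffs: `η = 1` on the ball of radius `1/2`, and `φ` is supported in the ball of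
radius `3/4` and dominates `|∇η|²`. -/
lemma exists_nested_cutoffs (n : ℕ) :
    ∃ η φ : EuclideanSpace ℝ (Fin n) → ℝ, ∃ M K L : ℝ,
      ContDiff ℝ (⊤ : ℕ∞) η ∧ ContDiff ℝ (⊤ : ℕ∞) φ ∧ HasCompactSupport η ∧ HasCompactSupport φ ∧
      (∀ x ∈ ball 0 (1 / 2), η x = 1) ∧ tsupport η ⊆ ball 0 (7 / 8) ∧
      tsupport φ ⊆ ball 0 (7 / 8) ∧ (∀ x, |η x| ≤ 1) ∧ (∀ x, |φ x| ≤ 1) ∧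
      (∀ x, ∑ i, partialDeriv' i η x ^ 2 ≤ M * φ x) ∧ (∀ x, |lap η x| ≤ K) ∧
      (∀ x, |lap φ x| ≤ L) ∧ 0 ≤ M := by
  let η : ContDiffBump (0 : EuclideanSpace ℝ (Fin n)) := ⟨1 / 2, 5 / 8, by norm_num, by norm_num⟩
  let φ : ContDiffBump (0 : EuclideanSpace ℝ (Fin n)) := ⟨5 / 8, 3 / 4, by norm_num, by norm_num⟩
  have hη : ContDiff ℝ (⊤ : ℕ∞) η := η.contDiff
  have hφ : ContDiff ℝ (⊤ : ℕ∞) φ := φ.contDiff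
  have hg : ContDiff ℝ (⊤ : ℕ∞) fun x => ∑ i, partialDeriv' i η x ^ 2 :=
    ContDiff.sum fun i _ => (hη.partialDeriv' i).pow 2
  have hg0 : ∀ x ∉ tsupport η, ∑ i, partialDeriv' i η x ^ 2 = 0 := fun x hx =>
    Finset.sum_eq_zero fun i _ => by
      rw [image_eq_zero_of_notMem_tsupport fun h => hx (tsupport_partialDeriv'_subset i h)]
      simp
  obtain ⟨M, hM⟩ := hg.continuous.bounded_above_of_compact_support
    (HasCompactSupport.intro η.hasCompactSupport hg0)
  obtain ⟨K, hK⟩ := hη.lap.continuous.bounded_above_of_compact_support η.hasCompactSupport.lap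
  obtain ⟨L, hL⟩ := hφ.lap.continuous.bounded_above_of_compact_support φ.hasCompactSupport.lap
  have hM0 : 0 ≤ M := (norm_nonneg _).trans (hM 0)
  refine ⟨η, φ, M, K, L, hη, hφ, η.hasCompactSupport, φ.hasCompactSupport,
    fun x hx => η.one_of_mem_closedBall (ball_subset_closedBall hx), ?_, ?_,
    fun x => abs_le.2 ⟨by linarith [η.nonneg (x := x)], η.le_one⟩,
    fun x => abs_le.2 ⟨by linarith [φ.nonneg (x := x)], φ.le_one⟩, fun x => ?_, hK, hL, hM0⟩
  · rw [η.tsupport_eq]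
    exact closedBall_subset_ball (by norm_num)
  · rw [φ.tsupport_eq]
    exact closedBall_subset_ball (by norm_num)
  · by_cases hx : x ∈ tsupport η
    · rw [φ.one_of_mem_closedBall (by rwa [η.tsupport_eq] at hx), mul_one]
      exact (le_abs_self _).trans (hM x)
    · rw [hg0 x hx]
      exact mul_nonneg hM0 φ.nonneg

/-- The interior energy estimate for globally smooth functions. -/
lemma exists_setLIntegral_hessFrobSq_le (n : ℕ) :
    ∃ C : ℝ, 0 < C ∧ ∀ v : EuclideanSpace ℝ (Fin n) → ℝ, ContDiff ℝ (⊤ : ℕ∞) v →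
      ∫⁻ x in ball 0 (1 / 2), ENNReal.ofReal (hessFrobSq v x) ≤
        ENNReal.ofReal C *
          ((∫⁻ x in ball 0 (7 / 8), ENNReal.ofReal (v x ^ 2)) +
            ∫⁻ x in ball 0 (7 / 8), ENNReal.ofReal (lap v x ^ 2)) := by
  obtain ⟨η, φ, M, K, L, hη, hφ, hηc, hφc, hη1, hηs, hφs, hηb, hφb, hM, hK, hL, hM0⟩ :=
    exists_nested_cutoffs n
  have hL0 : 0 ≤ L := (abs_nonneg _).trans (hL 0)
  refine ⟨3 + 3 * K ^ 2 + 6 * M * L + 6 * M, by positivity, fun v hv => ?_⟩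
  set C := 3 + 3 * K ^ 2 + 6 * M * L + 6 * M
  have hw : ContDiff ℝ (⊤ : ℕ∞) fun x => η x * v x := hη.mul hv
  have hwc : HasCompactSupport fun x => η x * v x := hηc.mul_right
  let A : EuclideanSpace ℝ (Fin n) → ℝ := fun x => 3 * (η x * lap v x) ^ 2 + 3 * (lap η x * v x) ^ 2
  let G : EuclideanSpace ℝ (Fin n) → ℝ := fun x => φ x * ∑ i, partialDeriv' i v x ^ 2
  let H : EuclideanSpace ℝ (Fin n) → ℝ := fun x => lap φ x * v x ^ 2 - 2 * (φ x * (v x * lap v x))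
  have hA : Integrable A :=
    ((contDiff_const.mul ((hη.mul hv.lap).pow 2)).add
      (contDiff_const.mul ((hη.lap.mul hv).pow 2))).continuous.integrable_of_hasCompactSupport
      (HasCompactSupport.intro hηc fun x hx => by
        simp [image_eq_zero_of_notMem_tsupport hx, lap_eq_zero_of_notMem_tsupport hx])
  have hG : Integrable G :=
    (hφ.mul (ContDiff.sum fun i _ => (hv.partialDeriv' i).pow 2)).continuous
      |>.integrable_of_hasCompactSupport hφc.mul_right
  have hH : Integrable H :=
    ((hφ.lap.mul (hv.pow 2)).sub (contDiff_const.mul (hφ.mul (hv.mul hv.lap)))).continuous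
      |>.integrable_of_hasCompactSupport (HasCompactSupport.intro hφc fun x hx => by
        simp [image_eq_zero_of_notMem_tsupport hx, lap_eq_zero_of_notMem_tsupport hx])
  have hlap (x : EuclideanSpace ℝ (Fin n)) :
      lap (fun x => η x * v x) x ^ 2 ≤ A x + 12 * M * G x := by
    have hcs := Finset.sum_mul_sq_le_sq_mul_sq Finset.univ (fun i => partialDeriv' i η x)
      fun i => partialDeriv' i v x
    have hmul := mul_le_mul_of_nonneg_right (hM x)
      (Finset.sum_nonneg fun i (_ : i ∈ Finset.univ) => sq_nonneg (partialDeriv' i v x))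
    rw [lap_mul hη hv]
    simp only [A, G]
    set s := ∑ i, partialDeriv' i η x * partialDeriv' i v x
    nlinarith [sq_nonneg (lap η x * v x - 2 * s), sq_nonneg (lap η x * v x - η x * lap v x),
      sq_nonneg (2 * s - η x * lap v x)]
  have hAH (x : EuclideanSpace ℝ (Fin n)) (hx : x ∉ ball (0 : EuclideanSpace ℝ (Fin n)) (7 / 8)) :
      A x + 6 * M * H x = 0 := by
    have h₁ : x ∉ tsupport η := fun h => hx (hηs h)
    have h₂ : x ∉ tsupport φ := fun h => hx (hφs h)
    simp [A, H, image_eq_zero_of_notMem_tsupport h₁, lap_eq_zero_of_notMem_tsupport h₁,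
      image_eq_zero_of_notMem_tsupport h₂, lap_eq_zero_of_notMem_tsupport h₂]
  have hbound (x : EuclideanSpace ℝ (Fin n)) :
      A x + 6 * M * H x ≤ C * (v x ^ 2 + lap v x ^ 2) := by
    have h₁ : (η x * lap v x) ^ 2 ≤ lap v x ^ 2 := by
      rw [mul_pow]
      exact mul_le_of_le_one_left (sq_nonneg _) ((sq_le_one_iff_abs_le_one _).2 (hηb x))
    have h₂ : (lap η x * v x) ^ 2 ≤ K ^ 2 * v x ^ 2 := by
      rw [mul_pow, ← sq_abs (lap η x)]
      gcongr
      exact hK x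
    have h₃ : lap φ x * v x ^ 2 ≤ L * v x ^ 2 := by
      gcongr
      exact (le_abs_self _).trans (hL x)
    have h₄ : -(2 * (φ x * (v x * lap v x))) ≤ v x ^ 2 + lap v x ^ 2 := by
      obtain ⟨h, h'⟩ := abs_le.1 (hφb x)
      nlinarith [mul_nonneg (sub_nonneg.2 h') (sq_nonneg (v x - lap v x)),
        mul_nonneg (neg_le_iff_add_nonneg.1 h) (sq_nonneg (v x + lap v x))]
    have h₅ : 6 * M * H x ≤ 6 * M * (L * v x ^ 2 + (v x ^ 2 + lap v x ^ 2)) := by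
      gcongr
      simp only [H]
      linarith
    have h₆ : 0 ≤ K ^ 2 * lap v x ^ 2 := by positivity
    have h₇ : 0 ≤ M * L * lap v x ^ 2 := by positivity
    simp only [A, C]
    nlinarith [sq_nonneg (v x)]
  have hvint {g : EuclideanSpace ℝ (Fin n) → ℝ} (hg : Continuous g) :
      IntegrableOn g (ball 0 (7 / 8)) :=
    (hg.continuousOn.integrableOn_compact (isCompact_closedBall _ _)).mono_set
      ball_subset_closedBall
  have hQ : IntegrableOn (fun x => C * (v x ^ 2 + lap v x ^ 2)) (ball 0 (7 / 8)) :=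
    hvint (continuous_const.mul ((hv.continuous.pow 2).add (hv.lap.continuous.pow 2)))
  have hhess (x : EuclideanSpace ℝ (Fin n)) : 0 ≤ hessFrobSq (fun x => η x * v x) x :=
    Finset.sum_nonneg fun i _ => Finset.sum_nonneg fun j _ => sq_nonneg _
  have hreal : ∫ x, hessFrobSq (fun x => η x * v x) x ≤
      ∫ x in ball 0 (7 / 8), C * (v x ^ 2 + lap v x ^ 2) :=
    calc ∫ x, hessFrobSq (fun x => η x * v x) x
        = ∫ x, lap (fun x => η x * v x) x ^ 2 := integral_hessFrobSq hw hwc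
      _ ≤ ∫ x, (A x + 12 * M * G x) :=
          integral_mono_of_nonneg (.of_forall fun _ => sq_nonneg _) (hA.add (hG.const_mul _))
            (.of_forall hlap)
      _ = ∫ x, (A x + 6 * M * H x) := by
          have h : 2 * ∫ x, G x = ∫ x, H x := two_mul_integral_mul_grad_sq hφ hv hφc
          rw [integral_add hA (hG.const_mul _), integral_add hA (hH.const_mul _),
            integral_const_mul, integral_const_mul, ← h]
          ring
      _ = ∫ x in ball 0 (7 / 8), (A x + 6 * M * H x) :=
          (setIntegral_eq_integral_of_forall_compl_eq_zero hAH).symm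
      _ ≤ _ := integral_mono (hA.add (hH.const_mul _)).integrableOn hQ hbound
  calc ∫⁻ x in ball 0 (1 / 2), ENNReal.ofReal (hessFrobSq v x)
      = ∫⁻ x in ball 0 (1 / 2), ENNReal.ofReal (hessFrobSq (fun x => η x * v x) x) := by
        refine setLIntegral_congr_fun measurableSet_ball fun x hx => ?_
        have h : v =ᶠ[nhds x] fun x => η x * v x := by
          filter_upwards [isOpen_ball.mem_nhds hx] with y hy
          rw [hη1 y hy, one_mul]
        simp only [h.hessFrobSq_eq]
    _ ≤ ∫⁻ x, ENNReal.ofReal (hessFrobSq (fun x => η x * v x) x) := setLIntegral_le_lintegral _ _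
    _ = ENNReal.ofReal (∫ x, hessFrobSq (fun x => η x * v x) x) :=
        (ofReal_integral_eq_lintegral_ofReal
          (hw.hessFrobSq.continuous.integrable_of_hasCompactSupport hwc.hessFrobSq)
          (.of_forall hhess)).symm
    _ ≤ ENNReal.ofReal (∫ x in ball 0 (7 / 8), C * (v x ^ 2 + lap v x ^ 2)) :=
        ENNReal.ofReal_le_ofReal hreal
    _ = _ := by
        have h₁ : IntegrableOn (fun x => v x ^ 2) (ball 0 (7 / 8)) := hvint (hv.continuous.pow 2)
        have h₂ : IntegrableOn (fun x => lap v x ^ 2) (ball 0 (7 / 8)) :=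
          hvint (hv.lap.continuous.pow 2)
        rw [integral_const_mul, ENNReal.ofReal_mul (by positivity),
          integral_add h₁ h₂,
          ENNReal.ofReal_add (integral_nonneg fun _ => sq_nonneg _)
            (integral_nonneg fun _ => sq_nonneg _),
          ofReal_integral_eq_lintegral_ofReal h₁ (.of_forall fun _ => sq_nonneg _),
          ofReal_integral_eq_lintegral_ofReal h₂ (.of_forall fun _ => sq_nonneg _)]

/-- A smooth function on the unit ball agrees on a smaller ball with a globally smooth one. -/
lemma exists_contDiff_eqOn_ball {n : ℕ} {u : EuclideanSpace ℝ (Fin n) → ℝ}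
    (hu : ContDiffOn ℝ (⊤ : ℕ∞) u (ball 0 1)) :
    ∃ v : EuclideanSpace ℝ (Fin n) → ℝ,
      ContDiff ℝ (⊤ : ℕ∞) v ∧ Set.EqOn u v (ball 0 (7 / 8)) := by
  let χ : ContDiffBump (0 : EuclideanSpace ℝ (Fin n)) :=
    ⟨7 / 8, 15 / 16, by norm_num, by norm_num⟩
  have hχ : tsupport χ ⊆ ball 0 1 := by
    rw [χ.tsupport_eq]
    exact closedBall_subset_ball (by norm_num)
  refine ⟨fun x => χ x * u x, contDiff_iff_contDiffAt.2 fun x => ?_, fun x hx => ?_⟩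
  · by_cases hx : x ∈ tsupport χ
    · exact χ.contDiffAt.mul (hu.contDiffAt (isOpen_ball.mem_nhds (hχ hx)))
    · refine (contDiffAt_const (c := 0)).congr_of_eventuallyEq ?_
      filter_upwards [notMem_tsupport_iff_eventuallyEq.1 hx] with y hy
      simp [hy]
  · simp [χ.one_of_mem_closedBall (ball_subset_closedBall hx)]

/-- Interior `W^{2,2}` energy estimate for the Laplacian (the case `p = 2`). -/
theorem energy_estimate_p_two (n : ℕ) (hn : 1 ≤ n) :
    ∃ C : ℝ, 0 < C ∧
      ∀ u f : EuclideanSpace ℝ (Fin n) → ℝ,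
        ContDiffOn ℝ (⊤ : ℕ∞) u (ball (0 : EuclideanSpace ℝ (Fin n)) 1) →
        ContDiffOn ℝ (⊤ : ℕ∞) f (ball (0 : EuclideanSpace ℝ (Fin n)) 1) →
        (∀ x ∈ ball (0 : EuclideanSpace ℝ (Fin n)) 1, lap u x = f x) →
        ∫⁻ x in ball (0 : EuclideanSpace ℝ (Fin n)) (1/2),
            ENNReal.ofReal (hessFrobSq u x) ≤
          ENNReal.ofReal C *
            ((∫⁻ x in ball (0 : EuclideanSpace ℝ (Fin n)) 1,
                ENNReal.ofReal ((u x) ^ 2)) +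
             (∫⁻ x in ball (0 : EuclideanSpace ℝ (Fin n)) 1,
                ENNReal.ofReal ((f x) ^ 2))) := by
  obtain ⟨C, hC, hest⟩ := exists_setLIntegral_hessFrobSq_le n
  refine ⟨C, hC, fun u f hu _ huf => ?_⟩
  obtain ⟨v, hv, huv⟩ := exists_contDiff_eqOn_ball hu
  have heq {x : EuclideanSpace ℝ (Fin n)} (hx : x ∈ ball 0 (7 / 8)) : u =ᶠ[nhds x] v :=
    huv.eventuallyEq_of_mem (isOpen_ball.mem_nhds hx)
  have hsub : ball (0 : EuclideanSpace ℝ (Fin n)) (7 / 8) ⊆ ball 0 1 :=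
    ball_subset_ball (by norm_num)
  calc ∫⁻ x in ball 0 (1 / 2), ENNReal.ofReal (hessFrobSq u x)
      = ∫⁻ x in ball 0 (1 / 2), ENNReal.ofReal (hessFrobSq v x) :=
        setLIntegral_congr_fun measurableSet_ball fun x hx => by
          simp only [(heq (ball_subset_ball (by norm_num) hx)).hessFrobSq_eq]
    _ ≤ _ := hest v hv
    _ = ENNReal.ofReal C * ((∫⁻ x in ball 0 (7 / 8), ENNReal.ofReal (u x ^ 2)) +
          ∫⁻ x in ball 0 (7 / 8), ENNReal.ofReal (f x ^ 2)) := by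
        congr 2
        · exact setLIntegral_congr_fun measurableSet_ball fun x hx => by simp only [huv hx]
        · exact setLIntegral_congr_fun measurableSet_ball fun x hx => by
            simp only [← huf x (hsub hx), (heq hx).lap_eq]
    _ ≤ _ := by
        gcongr
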